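/- Let e be an indeterminate and let n be a positive integer with n ≡ 5 (mod 8). Then Σ_{k=0}^{n−1} [12k+1]_q · (q,e,q^5/e; q^8)_k (q,q,q^3; q^4)_k / ((q^4,e,q^5/e; q^4)_k (q^8,q^8,q^6; q^8)_k) · q^{4k} ≡ 0 (mod Φ_n(q)^3), as a congruence of rational functions in q and e (this is the d = 4 case of the full-range sum up to n−1). -/

import Mathlib

open Finset

noncomputable section

abbrev R2 : Type := MvPolynomial (Fin 2) ℚ
abbrev K2 : Type := FractionRing R2

/-- The variable `q` as a rational function in `ℚ(q,e)`. -/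
def qv : K2 := algebraMap R2 K2 (MvPolynomial.X 0)

/-- The indeterminate `e` as a rational function in `ℚ(q,e)`. -/
def ev : K2 := algebraMap R2 K2 (MvPolynomial.X 1)

/-- The q-shifted factorial `(a; q)_k = (1-a)(1-aq)⋯(1-aq^{k-1})`. -/
def qPoch {R : Type*} [CommRing R] (a q : R) (k : ℕ) : R :=
  ∏ j ∈ Finset.range k, (1 - a * q ^ j)

/-- The q-integer `[m]_q = (1 - q^m)/(1 - q)`. -/
def qInt {K : Type*} [Field K] (q : K) (m : ℤ) : K := (1 - q ^ m) / (1 - q)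

/-- The n-th cyclotomic polynomial `Φ_n(q)` viewed inside `ℚ[q,e]`. -/
def Phi2 (n : ℕ) : R2 := Polynomial.aeval (MvPolynomial.X 0) (Polynomial.cyclotomic n ℚ)

/-- `A ≡ B (mod M)`: the polynomial `M` divides the numerator of the reduced form
of the rational function `A - B`. -/
def CongrMod2 (A B : K2) (M : R2) : Prop :=
  ∃ f g : R2, g ≠ 0 ∧ (∀ p : R2, Prime p → p ∣ g → ¬ p ∣ M) ∧
    (A - B) * algebraMap R2 K2 g = algebraMap R2 K2 M * algebraMap R2 K2 f

theorem qPoch_zero {R : Type*} [CommRing R] (a q : R) : qPoch a q 0 = 1 := by simp [qPoch]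

theorem qPoch_succ {R : Type*} [CommRing R] (a q : R) (k : ℕ) :
    qPoch a q (k + 1) = qPoch a q k * (1 - a * q ^ k) := by
  simp [qPoch, prod_range_succ]

theorem qPoch_succ' {R : Type*} [CommRing R] (a q : R) (k : ℕ) :
    qPoch a q (k + 1) = (1 - a) * qPoch (a * q) q k := by
  simp only [qPoch, prod_range_succ', pow_zero, mul_one, mul_comm (1 - a)]
  congr 1
  exact prod_congr rfl fun j _ => by ring

theorem qPoch_eq_zero {K : Type*} [Field K] {a q : K} {k : ℕ} (j : ℕ) (hj : j < k)
    (h : a * q ^ j = 1) : qPoch a q k = 0 :=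
  prod_eq_zero (mem_range.2 hj) (by rw [h, sub_self])

/-- The summand of the quadratic series. -/
def quadTerm {K : Type*} [Field K] (p a b f : K) (k : ℕ) : K :=
  (1 - a * p ^ (3 * k)) * (qPoch a p k * qPoch b p k * qPoch (p / b) p k) *
    (qPoch a (p ^ 2) k * qPoch f (p ^ 2) k * qPoch (a * p / f) (p ^ 2) k) /
    ((qPoch (p ^ 2) (p ^ 2) k * qPoch (a * p ^ 2 / b) (p ^ 2) k * qPoch (a * b * p) (p ^ 2) k) *
      (qPoch p p k * qPoch (a * p / f) p k * qPoch f p k)) * p ^ k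

/-- The antidifference, in `k`, of the contiguous relation between the series with parameters
`b / p ^ 2` and `b`. -/
def quadCert {K : Type*} [Field K] (p a b f : K) (k : ℕ) : K :=
  (qPoch a p (k + 1) * qPoch (b / p) p k * qPoch (p ^ 2 / b) p k) *
    (qPoch a (p ^ 2) (k + 1) * qPoch f (p ^ 2) (k + 1) * qPoch (a * p / f) (p ^ 2) (k + 1)) /
    ((qPoch (p ^ 2) (p ^ 2) k * qPoch (a * p ^ 4 / b) (p ^ 2) k * qPoch (a * b * p) (p ^ 2) k) *
      (qPoch p p k * qPoch (a * p / f) p k * qPoch f p k))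

/-- The rational identity behind `sum_quadTerm_shift`, with `Q` standing for `p ^ k`. -/
theorem quadCert_identity {K : Type*} [Field K] {p a b f : K} (Q : K) (hp : p ≠ 0) (ha : a ≠ 0)
    (hb : b ≠ 0) (hf : f ≠ 0) :
    (1 - a * Q ^ 3) * Q * ((1 - b / p ^ 2) * (1 - p * Q / b) * (1 - p ^ 2 * Q / b) *
      (1 - f * p / b) * (1 - b * f / (a * p ^ 2)) * (1 - a * b * Q ^ 2 / p) -
      (1 - b * f / p ^ 2) * (1 - f * p / (a * b)) * (1 - b * Q / p ^ 2) * (1 - b * Q / p) *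
      (1 - p / b) * (1 - a * p ^ 2 * Q ^ 2 / b)) =
    -(b / p - p ^ 2 / b) * (f / (a * p)) * ((1 - a * Q) * (1 - a * Q ^ 2) * (1 - b * Q / p ^ 2) *
      (1 - p * Q / b) * (1 - f * Q ^ 2) * (1 - a * p * Q ^ 2 / f) -
      (1 - Q ^ 2) * (1 - Q) * (1 - a * p ^ 2 * Q ^ 2 / b) * (1 - a * b * Q ^ 2 / p) *
      (1 - f * Q / p) * (1 - a * Q / f)) := by
  field_simp
  ring

theorem quadTerm_succ_eq {K : Type*} [Field K] {p a b f : K} {k : ℕ} (hp : p ≠ 0)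
    (hb : b ≠ 0) (h₁ : 1 - b / p ≠ 0) :
    quadTerm p a b f (k + 1) = quadCert p a b f k *
      ((1 - a * (p ^ (k + 1)) ^ 3) * p ^ (k + 1) * (1 - b * p ^ (k + 1) / p ^ 2) *
        (1 - b * p ^ (k + 1) / p) * (1 - p / b) /
        ((1 - b / p) * (1 - a * p ^ 2 / b) * (1 - a * b * (p ^ (k + 1)) ^ 2 / p) *
          (1 - (p ^ (k + 1)) ^ 2) * (1 - p ^ (k + 1)) * (1 - a * p ^ (k + 1) / f) *
          (1 - f * p ^ (k + 1) / p))) := by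
  have e₁ : qPoch b p (k + 1) = qPoch (b / p) p k * (1 - b * p ^ (k + 1) / p ^ 2) *
      (1 - b * p ^ (k + 1) / p) / (1 - b / p) := by
    rw [eq_div_iff h₁]
    have h := qPoch_succ' (b / p) p (k + 1)
    rw [qPoch_succ, qPoch_succ, div_mul_cancel₀ _ hp] at h
    rw [mul_comm, ← h]
    congr 1
    · congr 2; field_simp; ring
    · congr 1; field_simp
  have e₂ : qPoch (p / b) p (k + 1) = (1 - p / b) * qPoch (p ^ 2 / b) p k := by
    rw [qPoch_succ']; congr 2; ring
  have e₃ : qPoch (a * p ^ 2 / b) (p ^ 2) (k + 1) =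
      (1 - a * p ^ 2 / b) * qPoch (a * p ^ 4 / b) (p ^ 2) k := by
    rw [qPoch_succ']; congr 2; ring
  have e₄ : qPoch (a * b * p) (p ^ 2) (k + 1) =
      qPoch (a * b * p) (p ^ 2) k * (1 - a * b * (p ^ (k + 1)) ^ 2 / p) := by
    rw [qPoch_succ]; congr 2; field_simp; ring
  have e₅ : qPoch (p ^ 2) (p ^ 2) (k + 1) =
      qPoch (p ^ 2) (p ^ 2) k * (1 - (p ^ (k + 1)) ^ 2) := by
    rw [qPoch_succ]; congr 2; ring
  have e₆ : qPoch p p (k + 1) = qPoch p p k * (1 - p ^ (k + 1)) := by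
    rw [qPoch_succ]; congr 2; ring
  have e₇ : qPoch (a * p / f) p (k + 1) =
      qPoch (a * p / f) p k * (1 - a * p ^ (k + 1) / f) := by
    rw [qPoch_succ]; congr 2; ring
  have e₈ : qPoch f p (k + 1) = qPoch f p k * (1 - f * p ^ (k + 1) / p) := by
    rw [qPoch_succ]; congr 2; field_simp; ring
  rw [quadTerm, quadCert, e₁, e₂, e₃, e₄, e₅, e₆, e₇, e₈, mul_comm 3, pow_mul]
  simp only [div_eq_mul_inv, mul_inv]
  ring

theorem quadTerm_shift_succ_eq {K : Type*} [Field K] {p a b f : K} {k : ℕ} (hp : p ≠ 0)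
    (hb : b ≠ 0) (h₁ : 1 - p ^ 2 / b ≠ 0) :
    quadTerm p a (b / p ^ 2) f (k + 1) = quadCert p a b f k *
      ((1 - a * (p ^ (k + 1)) ^ 3) * p ^ (k + 1) * (1 - b / p ^ 2) *
        (1 - p * p ^ (k + 1) / b) * (1 - p ^ 2 * p ^ (k + 1) / b) /
        ((1 - p ^ 2 / b) * (1 - a * b / p) * (1 - a * p ^ 2 * (p ^ (k + 1)) ^ 2 / b) *
          (1 - (p ^ (k + 1)) ^ 2) * (1 - p ^ (k + 1)) * (1 - a * p ^ (k + 1) / f) *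
          (1 - f * p ^ (k + 1) / p))) := by
  have e₁ : qPoch (p / (b / p ^ 2)) p (k + 1) =
      qPoch (p ^ 2 / b) p k * (1 - p * p ^ (k + 1) / b) *
      (1 - p ^ 2 * p ^ (k + 1) / b) / (1 - p ^ 2 / b) := by
    rw [eq_div_iff h₁]
    have h := qPoch_succ' (p ^ 2 / b) p (k + 1)
    rw [qPoch_succ, qPoch_succ, show p ^ 2 / b * p = p / (b / p ^ 2) by field_simp] at h
    rw [mul_comm, ← h]
    congr 1
    · congr 2; field_simp; ring
    · congr 1; field_simp
  have e₂ : qPoch (b / p ^ 2) p (k + 1) = (1 - b / p ^ 2) * qPoch (b / p) p k := by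
    rw [qPoch_succ']; congr 2; field_simp
  have e₃ : qPoch (a * p ^ 2 / (b / p ^ 2)) (p ^ 2) (k + 1) =
      qPoch (a * p ^ 4 / b) (p ^ 2) k * (1 - a * p ^ 2 * (p ^ (k + 1)) ^ 2 / b) := by
    rw [qPoch_succ, show a * p ^ 2 / (b / p ^ 2) = a * p ^ 4 / b by field_simp]
    congr 2; field_simp; ring
  have e₄ : qPoch (a * (b / p ^ 2) * p) (p ^ 2) (k + 1) =
      (1 - a * b / p) * qPoch (a * b * p) (p ^ 2) k := by
    rw [qPoch_succ']; congr 2 <;> field_simp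
  have e₅ : qPoch (p ^ 2) (p ^ 2) (k + 1) =
      qPoch (p ^ 2) (p ^ 2) k * (1 - (p ^ (k + 1)) ^ 2) := by
    rw [qPoch_succ]; congr 2; ring
  have e₆ : qPoch p p (k + 1) = qPoch p p k * (1 - p ^ (k + 1)) := by
    rw [qPoch_succ]; congr 2; ring
  have e₇ : qPoch (a * p / f) p (k + 1) =
      qPoch (a * p / f) p k * (1 - a * p ^ (k + 1) / f) := by
    rw [qPoch_succ]; congr 2; ring
  have e₈ : qPoch f p (k + 1) = qPoch f p k * (1 - f * p ^ (k + 1) / p) := by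
    rw [qPoch_succ]; congr 2; field_simp; ring
  rw [quadTerm, quadCert, e₁, e₂, e₃, e₄, e₅, e₆, e₇, e₈, mul_comm 3, pow_mul]
  simp only [div_eq_mul_inv, mul_inv]
  ring

theorem quadCert_succ {K : Type*} [Field K] {p a b f : K} {k : ℕ} (hp : p ≠ 0) :
    quadCert p a b f (k + 1) = quadCert p a b f k *
      ((1 - a * p ^ (k + 1)) * (1 - a * (p ^ (k + 1)) ^ 2) * (1 - b * p ^ (k + 1) / p ^ 2) *
        (1 - p * p ^ (k + 1) / b) * (1 - f * (p ^ (k + 1)) ^ 2) *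
        (1 - a * p * (p ^ (k + 1)) ^ 2 / f) /
        ((1 - (p ^ (k + 1)) ^ 2) * (1 - p ^ (k + 1)) * (1 - a * p ^ 2 * (p ^ (k + 1)) ^ 2 / b) *
          (1 - a * b * (p ^ (k + 1)) ^ 2 / p) * (1 - f * p ^ (k + 1) / p) *
          (1 - a * p ^ (k + 1) / f))) := by
  have e₁ : qPoch a (p ^ 2) (k + 1 + 1) =
      qPoch a (p ^ 2) (k + 1) * (1 - a * (p ^ (k + 1)) ^ 2) := by
    rw [qPoch_succ]; congr 2; ring
  have e₂ : qPoch f (p ^ 2) (k + 1 + 1) =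
      qPoch f (p ^ 2) (k + 1) * (1 - f * (p ^ (k + 1)) ^ 2) := by
    rw [qPoch_succ]; congr 2; ring
  have e₃ : qPoch (a * p / f) (p ^ 2) (k + 1 + 1) =
      qPoch (a * p / f) (p ^ 2) (k + 1) * (1 - a * p * (p ^ (k + 1)) ^ 2 / f) := by
    rw [qPoch_succ]; congr 2; ring
  have e₄ : qPoch (a * b * p) (p ^ 2) (k + 1) =
      qPoch (a * b * p) (p ^ 2) k * (1 - a * b * (p ^ (k + 1)) ^ 2 / p) := by
    rw [qPoch_succ]; congr 2; field_simp; ring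
  have e₅ : qPoch (p ^ 2) (p ^ 2) (k + 1) =
      qPoch (p ^ 2) (p ^ 2) k * (1 - (p ^ (k + 1)) ^ 2) := by
    rw [qPoch_succ]; congr 2; ring
  have e₆ : qPoch p p (k + 1) = qPoch p p k * (1 - p ^ (k + 1)) := by
    rw [qPoch_succ]; congr 2; ring
  have e₇ : qPoch (a * p / f) p (k + 1) =
      qPoch (a * p / f) p k * (1 - a * p ^ (k + 1) / f) := by
    rw [qPoch_succ]; congr 2; ring
  have e₈ : qPoch f p (k + 1) = qPoch f p k * (1 - f * p ^ (k + 1) / p) := by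
    rw [qPoch_succ]; congr 2; field_simp; ring
  have e₉ : qPoch (b / p) p (k + 1) = qPoch (b / p) p k * (1 - b * p ^ (k + 1) / p ^ 2) := by
    rw [qPoch_succ]; congr 2; field_simp; ring
  have e₁₀ : qPoch (p ^ 2 / b) p (k + 1) =
      qPoch (p ^ 2 / b) p k * (1 - p * p ^ (k + 1) / b) := by
    rw [qPoch_succ]; congr 2; ring
  have e₁₁ : qPoch (a * p ^ 4 / b) (p ^ 2) (k + 1) =
      qPoch (a * p ^ 4 / b) (p ^ 2) k * (1 - a * p ^ 2 * (p ^ (k + 1)) ^ 2 / b) := by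
    rw [qPoch_succ]; congr 2; ring
  rw [quadCert, quadCert, qPoch_succ a p (k + 1), e₁, e₂, e₃, e₄, e₅, e₆, e₇, e₈, e₉, e₁₀, e₁₁]
  simp only [div_eq_mul_inv, mul_inv]
  ring

/-- The contiguous relation `b ↦ b / p ^ 2` for partial sums of the quadratic series. -/
theorem sum_quadTerm_shift {K : Type*} [Field K] {p a b f : K} (hp : p ≠ 0) (ha : a ≠ 0)
    (hb : b ≠ 0) (hf : f ≠ 0) (h₁ : 1 - b / p ≠ 0) (h₂ : 1 - p ^ 2 / b ≠ 0)
    (h₃ : 1 - a * b / p ≠ 0) (N : ℕ)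
    (h₄ : ∀ j, 1 - p ^ (j + 1) ≠ 0) (h₅ : ∀ j, 1 - f * p ^ j ≠ 0)
    (h₆ : ∀ j, 1 - a * p ^ (j + 1) / f ≠ 0)
    (h₇ : ∀ j ≤ N, 1 - a * p ^ (2 * j + 2) / b ≠ 0)
    (h₈ : ∀ j < N, 1 - a * b * p ^ (2 * j + 1) ≠ 0) :
    (1 - p ^ 2 / b) * (1 - f * p / b) * (1 - a * b / p) * (1 - b * f / (a * p ^ 2)) *
        ∑ k ∈ range (N + 1), quadTerm p a (b / p ^ 2) f k -
      (1 - b / p) * (1 - b * f / p ^ 2) * (1 - a * p ^ 2 / b) * (1 - f * p / (a * b)) *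
        ∑ k ∈ range (N + 1), quadTerm p a b f k =
      -(b / p - p ^ 2 / b) * (f / (a * p)) * quadCert p a b f N := by
  induction N with
  | zero =>
    simp only [zero_add, sum_range_one, quadTerm, quadCert, qPoch_zero, qPoch_succ]
    field_simp
    ring
  | succ N ih =>
    rw [sum_range_succ, sum_range_succ _ (N + 1)]
    have ih' := ih (fun j hj => h₇ j (by omega)) (fun j hj => h₈ j (by omega))
    rw [quadTerm_succ_eq hp hb h₁, quadTerm_shift_succ_eq hp hb h₂, quadCert_succ hp]
    have n₁ := h₄ N
    have n₂ : 1 - (p ^ (N + 1)) ^ 2 ≠ 0 := by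
      have := h₄ (2 * N + 1)
      rwa [← pow_mul, show (N + 1) * 2 = 2 * N + 1 + 1 by ring]
    have n₃ : 1 - f * p ^ (N + 1) / p ≠ 0 := by
      have := h₅ N
      rwa [pow_succ, ← mul_assoc, mul_div_cancel_right₀ _ hp]
    have n₄ := h₆ N
    have n₅ : 1 - a * p ^ 2 * (p ^ (N + 1)) ^ 2 / b ≠ 0 := by
      have := h₇ (N + 1) le_rfl
      rwa [show a * p ^ 2 * (p ^ (N + 1)) ^ 2 = a * p ^ (2 * (N + 1) + 2) by ring]
    have n₆ : 1 - a * b * (p ^ (N + 1)) ^ 2 / p ≠ 0 := by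
      have := h₈ N (by omega)
      rwa [show a * b * (p ^ (N + 1)) ^ 2 / p = a * b * p ^ (2 * N + 1) by field_simp; ring]
    have n₇ : 1 - a * p ^ 2 / b ≠ 0 := by simpa using h₇ 0 (by omega)
    have key := quadCert_identity (p ^ (N + 1)) hp ha hb hf
    generalize p ^ (N + 1) = Q at *
    generalize quadCert p a b f N = E at *
    generalize ∑ k ∈ range (N + 1), quadTerm p a (b / p ^ 2) f k = S₁ at *
    generalize ∑ k ∈ range (N + 1), quadTerm p a b f k = S₂ at *
    rw [mul_add, mul_add, add_sub_add_comm, ih']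
    generalize 1 - a * p ^ 2 / b = y₁ at *
    generalize 1 - b / p = y₂ at *
    generalize 1 - p ^ 2 / b = y₃ at *
    generalize 1 - a * b / p = y₄ at *
    generalize 1 - a * b * Q ^ 2 / p = y₅ at *
    generalize 1 - a * p ^ 2 * Q ^ 2 / b = y₆ at *
    generalize 1 - a * Q / f = y₇ at *
    generalize 1 - f * Q / p = y₈ at *
    generalize 1 - Q ^ 2 = y₉ at *
    generalize 1 - Q = y₁₀ at *
    generalize -(b / p - p ^ 2 / b) * (f / (a * p)) = c at *
    generalize 1 - b * f / (a * p ^ 2) = z₁ at *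
    generalize 1 - f * p / (a * b) = z₂ at *
    generalize 1 - f * p / b = z₃ at *
    generalize 1 - b * f / p ^ 2 = z₄ at *
    generalize 1 - b * Q / p ^ 2 = z₅ at *
    generalize 1 - b * Q / p = z₆ at *
    generalize 1 - p * Q / b = z₇ at *
    generalize 1 - p ^ 2 * Q / b = z₈ at *
    generalize 1 - a * p * Q ^ 2 / f = z₉ at *
    generalize 1 - p / b = z₁₀ at *
    generalize 1 - b / p ^ 2 = z₁₁ at *
    field_simp
    linear_combination E * key

theorem quadCert_eq_zero {K : Type*} [Field K] {p a f : K} {N t : ℕ} (hp : p ≠ 0)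
    (h : 2 * t + 3 ≤ N ∨ qPoch a (p ^ 2) (N + 1) = 0) :
    quadCert p a (p ^ (2 * t + 1))⁻¹ f N = 0 := by
  rcases h with h | h
  · have : qPoch ((p ^ (2 * t + 1))⁻¹ / p) p N = 0 :=
      qPoch_eq_zero (2 * t + 2) (by omega) (by field_simp; ring)
    simp [quadCert, this]
  · simp [quadCert, h]

theorem sum_quadTerm_inv {K : Type*} [Field K] {p a f : K} (hp : p ≠ 0) {N : ℕ} (hN : 1 ≤ N)
    (h₄ : ∀ j, 1 - p ^ (j + 1) ≠ 0) (h₅ : 1 - f ≠ 0) (h₆ : 1 - a * p / f ≠ 0)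
    (h₇ : 1 - a * p ^ 3 ≠ 0) :
    ∑ k ∈ range (N + 1), quadTerm p a p⁻¹ f k = 0 := by
  obtain ⟨M, rfl⟩ : ∃ M, N = M + 1 := ⟨N - 1, by omega⟩
  rw [sum_range_succ', sum_range_succ', sum_eq_zero]
  · have n₁ := h₄ 0
    have n₂ := h₄ 1
    simp only [zero_add, pow_one, one_add_one_eq_two] at n₁ n₂
    have e : a * p⁻¹ * p = a := by field_simp
    have e' : a * p ^ 2 / p⁻¹ = a * p ^ 3 := by field_simp
    have e'' : p / p⁻¹ = p ^ 2 := by field_simp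
    simp only [quadTerm, qPoch_zero, qPoch_succ, zero_add, e, e', e'', pow_zero, mul_one, one_mul,
      pow_one, mul_zero, div_one]
    generalize 1 - a * p ^ 3 = y₁ at *
    generalize 1 - a * p / f = y₂ at *
    generalize 1 - a = y₃ at *
    generalize 1 - f = y₄ at *
    generalize 1 - p ^ 2 = y₅ at *
    field_simp
    ring
  · intro k _
    have : qPoch p⁻¹ p (k + 1 + 1) = 0 :=
      qPoch_eq_zero 1 (by omega) (by field_simp)
    simp [quadTerm, this]

/-- The series with parameter `b = p ^ (-m)`, `m` odd, vanishes. -/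
theorem sum_quadTerm_odd {K : Type*} [Field K] {p a f : K} (hp : p ≠ 0) (ha : a ≠ 0)
    (hf : f ≠ 0) {N : ℕ} (hN : 1 ≤ N) (h₄ : ∀ j, 1 - p ^ (j + 1) ≠ 0)
    (h₅ : ∀ j, 1 - f * p ^ j ≠ 0) (h₆ : ∀ j, 1 - a * p ^ (j + 1) / f ≠ 0)
    (h₇ : ∀ j, 1 - a * p ^ (2 * j + 3) ≠ 0) (h₈ : ∀ t, ∀ j < N, a * p ^ (2 * j) ≠ p ^ (2 * t))
    (h₃ : ∀ t, a ≠ p ^ (2 * t + 2)) (t : ℕ)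
    (ht : 2 * t + 1 ≤ N ∨ qPoch a (p ^ 2) (N + 1) = 0) :
    ∑ k ∈ range (N + 1), quadTerm p a (p ^ (2 * t + 1))⁻¹ f k = 0 := by
  induction t with
  | zero =>
    simpa using sum_quadTerm_inv hp hN h₄ (by simpa using h₅ 0) (by simpa using h₆ 0)
      (by simpa using h₇ 0)
  | succ t ih =>
    have hb : (p ^ (2 * t + 1))⁻¹ ≠ 0 := inv_ne_zero (pow_ne_zero _ hp)
    have m₁ : 1 - p ^ 2 / (p ^ (2 * t + 1))⁻¹ ≠ 0 := by
      have := h₄ (2 * t + 2)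
      rwa [div_inv_eq_mul, ← pow_add, show 2 + (2 * t + 1) = 2 * t + 2 + 1 by ring]
    have m₂ : 1 - a * (p ^ (2 * t + 1))⁻¹ / p ≠ 0 := by
      have := h₃ t
      contrapose! this
      field_simp at this
      linear_combination -this
    have m₃ : 1 - f * p / (p ^ (2 * t + 1))⁻¹ ≠ 0 := by
      have := h₅ (2 * t + 2)
      rwa [div_inv_eq_mul, mul_assoc, ← pow_succ']
    have m₄ : 1 - (p ^ (2 * t + 1))⁻¹ * f / (a * p ^ 2) ≠ 0 := by
      have := h₆ (2 * t + 2)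
      contrapose! this
      field_simp at this ⊢
      linear_combination -this
    have m₅ : 1 - (p ^ (2 * t + 1))⁻¹ / p ≠ 0 := by
      have := h₄ (2 * t + 1)
      contrapose! this
      field_simp at this
      linear_combination -this
    have key := sum_quadTerm_shift (f := f) hp ha hb hf m₅ m₁ m₂ N h₄ h₅ h₆
      (fun j _ => by
        have := h₇ (j + t)
        rwa [div_inv_eq_mul, mul_assoc, ← pow_add,
          show 2 * j + 2 + (2 * t + 1) = 2 * (j + t) + 3 by ring])
      (fun j hj => by
        have := h₈ t j hj
        contrapose! this
        field_simp at this
        rw [pow_succ, pow_succ] at this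
        refine mul_right_cancel₀ hp ?_
        linear_combination -this)
    rw [quadCert_eq_zero hp (ht.imp_left fun h => by omega),
      ih (ht.imp_left fun h => by omega), mul_zero, mul_zero, sub_zero] at key
    have hshift : (p ^ (2 * (t + 1) + 1))⁻¹ = (p ^ (2 * t + 1))⁻¹ / p ^ 2 := by
      field_simp; ring
    rw [hshift]
    exact (mul_eq_zero.1 key).resolve_left
      (mul_ne_zero (mul_ne_zero (mul_ne_zero m₁ m₃) m₂) m₄)

open Polynomial in
/-- The numerator of `∑ k ≤ N, c k * ∏ j < k, u j / v j` over the denominator `∏ j < N, v j`. -/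
def clearedSum {O : Type*} [CommRing O] (c u v : ℕ → O[X]) (N : ℕ) : O[X] :=
  ∑ k ∈ range (N + 1), c k * (∏ j ∈ range k, u j) * ∏ j ∈ Ico k N, v j

open Polynomial in
theorem aeval_clearedSum {O K : Type*} [CommRing O] [Field K] [Algebra O K] (c u v : ℕ → O[X])
    (N : ℕ) (x : K) (hv : ∀ j < N, aeval x (v j) ≠ 0) :
    aeval x (clearedSum c u v N) =
      (∑ k ∈ range (N + 1), aeval x (c k) * ∏ j ∈ range k, aeval x (u j) / aeval x (v j)) *
        ∏ j ∈ range N, aeval x (v j) := by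
  rw [clearedSum, map_sum, sum_mul]
  refine sum_congr rfl fun k hk => ?_
  have hk' : k ≤ N := by simpa [Nat.lt_succ_iff] using hk
  rw [map_mul, map_mul, map_prod, map_prod, prod_div_distrib,
    ← prod_range_mul_prod_Ico (fun j => aeval x (v j)) hk']
  have : ∏ j ∈ range k, aeval x (v j) ≠ 0 :=
    prod_ne_zero_iff.2 fun j hj => hv j (by simp at hj; omega)
  field_simp

/-- The quotient of consecutive products in `quadTerm`. -/
def quadRatio {K : Type*} [Field K] (p a b f : K) (j : ℕ) : K :=
  (1 - a * p ^ j) * (1 - b * p ^ j) * (1 - p / b * p ^ j) *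
    ((1 - a * (p ^ 2) ^ j) * (1 - f * (p ^ 2) ^ j) * (1 - a * p / f * (p ^ 2) ^ j)) /
    ((1 - p ^ 2 * (p ^ 2) ^ j) * (1 - a * p ^ 2 / b * (p ^ 2) ^ j) *
      (1 - a * b * p * (p ^ 2) ^ j) *
      ((1 - p * p ^ j) * (1 - a * p / f * p ^ j) * (1 - f * p ^ j))) * p

theorem quadTerm_eq_prod {K : Type*} [Field K] (p a b f : K) (k : ℕ) :
    quadTerm p a b f k = (1 - a * p ^ (3 * k)) * ∏ j ∈ range k, quadRatio p a b f j := by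
  simp only [quadTerm, quadRatio, qPoch, prod_mul_distrib, prod_div_distrib, prod_const, card_range]
  ring

theorem quadTerm_div {K : Type*} [Field K] {p : K} (hp : p ≠ 0) (a b f : K) (k : ℕ) :
    quadTerm p a (p / b) f k = quadTerm p a b f k := by
  rw [quadTerm, quadTerm, div_div_cancel₀ hp]
  rcases eq_or_ne b 0 with rfl | hb
  · simp [mul_comm, mul_left_comm]
  · rw [show a * p ^ 2 / (p / b) = a * b * p by field_simp,
      show a * (p / b) * p = a * p ^ 2 / b by ring]
    ring

open Polynomial in
/-- If `a = p ^ (-2 s)`, the terminating series vanishes identically in `b`. -/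
theorem sum_quadTerm_eq_zero_of_forall_odd {K : Type*} [Field K] {p a f : K} (hp : p ≠ 0) {s : ℕ}
    (hinj : Function.Injective fun t : ℕ => (p ^ (2 * t + 1))⁻¹)
    (h₄ : ∀ j, 1 - p ^ (j + 1) ≠ 0)
    (h₅ : ∀ j, 1 - f * p ^ j ≠ 0) (h₆ : ∀ j, 1 - a * p ^ (j + 1) / f ≠ 0)
    (h₇ : ∀ j, 1 - a * p ^ (2 * j + 3) ≠ 0) (h₈ : ∀ t, ∀ j < s, a * p ^ (2 * j) ≠ p ^ (2 * t))
    (hodd : ∀ t : ℕ, ∑ k ∈ range (s + 1), quadTerm p a (p ^ (2 * t + 1))⁻¹ f k = 0)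
    {b : K} (hb : b ≠ 0) (h₁ : ∀ j, b - a * p ^ (2 * j + 2) ≠ 0)
    (h₂ : ∀ j, 1 - a * b * p ^ (2 * j + 1) ≠ 0) :
    ∑ k ∈ range (s + 1), quadTerm p a b f k = 0 := by
  let c : ℕ → K[X] := fun k => C (1 - a * p ^ (3 * k))
  let u : ℕ → K[X] := fun j => C ((1 - a * p ^ j) * (1 - a * p ^ (2 * j)) *
    (1 - f * p ^ (2 * j)) * (1 - a * p ^ (2 * j + 1) / f) * p) *
    ((1 - C (p ^ j) * X) * (X - C (p ^ (j + 1))))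
  let v : ℕ → K[X] := fun j => C ((1 - p ^ (2 * j + 1 + 1)) * (1 - p ^ (j + 1)) *
    (1 - a * p ^ (j + 1) / f) * (1 - f * p ^ j)) *
    ((X - C (a * p ^ (2 * j + 2))) * (1 - C (a * p ^ (2 * j + 1)) * X))
  have hratio : ∀ x : K, x ≠ 0 → ∀ j, aeval x (u j) / aeval x (v j) = quadRatio p a x f j := by
    intro x hx j
    have e₁ : x - p ^ (j + 1) = x * (1 - p / x * p ^ j) := by field_simp; ring
    have e₂ : x - a * p ^ (2 * j + 2) = x * (1 - a * p ^ 2 / x * (p ^ 2) ^ j) := by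
      field_simp; ring
    simp only [u, v, quadRatio, map_mul, map_sub, aeval_C, aeval_X, map_one,
      Algebra.algebraMap_self, RingHom.id_apply]
    rw [e₁, e₂]
    generalize 1 - p / x * p ^ j = y
    generalize hz : 1 - a * p ^ 2 / x * (p ^ 2) ^ j = z
    rw [mul_assoc x z, mul_left_comm _ x, mul_left_comm _ x, mul_left_comm _ x,
      mul_div_mul_left _ _ hx]
    simp only [div_eq_mul_inv, mul_inv]
    ring_nf
  have heval : ∀ x : K, x ≠ 0 → (∀ j < s, x - a * p ^ (2 * j + 2) ≠ 0) →
      (∀ j < s, 1 - a * x * p ^ (2 * j + 1) ≠ 0) →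
      (∀ j < s, aeval x (v j) ≠ 0) ∧ aeval x (clearedSum c u v s) =
        (∑ k ∈ range (s + 1), quadTerm p a x f k) * ∏ j ∈ range s, aeval x (v j) := by
    intro x hx h₁ h₂
    have hv : ∀ j < s, aeval x (v j) ≠ 0 := by
      intro j hj
      simp only [v, map_mul, map_sub, aeval_C, aeval_X, map_one,
        Algebra.algebraMap_self, RingHom.id_apply, mul_ne_zero_iff]
      refine ⟨⟨⟨⟨h₄ _, h₄ j⟩, h₆ j⟩, h₅ j⟩, h₁ j hj, ?_⟩
      have := h₂ j hj
      rwa [mul_right_comm] at this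
    refine ⟨hv, ?_⟩
    rw [aeval_clearedSum _ _ _ _ _ hv]
    congr 1
    refine sum_congr rfl fun k _ => ?_
    rw [quadTerm_eq_prod, prod_congr rfl fun j _ => hratio x hx j, aeval_C]
    rfl
  have hzero : clearedSum c u v s = 0 := by
    refine eq_zero_of_infinite_isRoot _ (Set.infinite_of_injective_forall_mem hinj fun t => ?_)
    have hx : (p ^ (2 * t + 1))⁻¹ ≠ 0 := inv_ne_zero (pow_ne_zero _ hp)
    have := (heval _ hx (fun j _ => ?_) fun j hj => ?_).2
    · rwa [hodd, zero_mul] at this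
    · have := h₇ (j + t)
      contrapose! this
      field_simp at this
      linear_combination this
    · have := h₈ t j hj
      contrapose! this
      field_simp at this
      rw [pow_succ, pow_succ] at this
      refine mul_right_cancel₀ hp ?_
      linear_combination -this
  obtain ⟨hv, h⟩ := heval b hb (fun j _ => h₁ j) fun j _ => h₂ j
  rw [hzero, map_zero] at h
  exact (mul_eq_zero.1 h.symm).resolve_right
    (prod_ne_zero_iff.2 fun j hj => hv j (mem_range.1 hj))

/-- Vanishing of the series for `b = q ^ (-4 m)`, `m` odd, and `a` an even power of `q` which is
not a power of `q ^ 4`. -/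
theorem sum_quadTerm_zpow_odd {K : Type*} [Field K] {q f : K} (hq : q ≠ 0)
    (hinj : Function.Injective fun i : ℤ => q ^ i) (hf₀ : f ≠ 0) (hf : ∀ i : ℤ, f ≠ q ^ i)
    {r : ℤ} (hr : r % 4 = 2) {N t : ℕ} (ht : 2 * t + 1 ≤ N) :
    ∑ k ∈ range (N + 1), quadTerm (q ^ 4) (q ^ r) ((q ^ 4) ^ (2 * t + 1))⁻¹ f k = 0 := by
  have hne : ∀ i j : ℤ, i ≠ j → q ^ i ≠ q ^ j := fun i j h h' => h (hinj h')
  refine sum_quadTerm_odd (pow_ne_zero _ hq) (zpow_ne_zero _ hq) hf₀ (by omega) (fun j => ?_)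
    (fun j => ?_) (fun j => ?_) (fun j => ?_) (fun t j _ => ?_) (fun t => ?_) t (Or.inl ht)
  · rw [sub_ne_zero, ← pow_mul, ← zpow_natCast, ← zpow_zero q]
    exact hne _ _ (by push_cast; omega)
  · rw [sub_ne_zero, ← pow_mul, ← zpow_natCast]
    intro h
    refine hf (-((4 * j : ℕ) : ℤ)) ?_
    rw [zpow_neg]
    exact eq_inv_of_mul_eq_one_left h.symm
  · rw [sub_ne_zero, ← pow_mul, ← zpow_natCast, ← zpow_add₀ hq, ne_comm, Ne, div_eq_one_iff_eq hf₀]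
    exact (hf _).symm
  · rw [sub_ne_zero, ← pow_mul, ← zpow_natCast, ← zpow_add₀ hq, ← zpow_zero q]
    exact hne _ _ (by push_cast; omega)
  · rw [← pow_mul, ← pow_mul, ← zpow_natCast, ← zpow_natCast, ← zpow_add₀ hq]
    exact hne _ _ (by push_cast; omega)
  · rw [← pow_mul, ← zpow_natCast]
    exact hne _ _ (by push_cast; omega)

/-- Vanishing of the series for `a = q ^ (-8 s)` and `b` an even power of `q` which is not a power
of `q ^ 4`. -/
theorem sum_quadTerm_zpow_neg {K : Type*} [Field K] {q f : K} (hq : q ≠ 0)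
    (hinj : Function.Injective fun i : ℤ => q ^ i) (hf₀ : f ≠ 0) (hf : ∀ i : ℤ, f ≠ q ^ i)
    {r : ℤ} (hr : r % 4 = 2) {s N : ℕ} (hs : 1 ≤ s) (hN : s ≤ N) :
    ∑ k ∈ range (N + 1), quadTerm (q ^ 4) (q ^ (-(8 * s : ℤ))) (q ^ r) f k = 0 := by
  have hne : ∀ i j : ℤ, i ≠ j → q ^ i ≠ q ^ j := fun i j h h' => h (hinj h')
  have hp : q ^ 4 ≠ 0 := pow_ne_zero _ hq
  have hzero : ∀ k, s < k → qPoch (q ^ (-(8 * s : ℤ))) ((q ^ 4) ^ 2) k = 0 := by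
    intro k hk
    refine qPoch_eq_zero s hk ?_
    rw [← pow_mul, ← pow_mul, ← zpow_natCast, ← zpow_add₀ hq]
    convert zpow_zero q using 2
    push_cast
    ring
  have h₄ : ∀ j, 1 - (q ^ 4) ^ (j + 1) ≠ 0 := fun j => by
    rw [sub_ne_zero, ← pow_mul, ← zpow_natCast, ← zpow_zero q]
    exact hne _ _ (by push_cast; omega)
  have h₅ : ∀ j, 1 - f * (q ^ 4) ^ j ≠ 0 := fun j => by
    rw [sub_ne_zero, ← pow_mul, ← zpow_natCast]
    intro h
    refine hf (-((4 * j : ℕ) : ℤ)) ?_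
    rw [zpow_neg]
    exact eq_inv_of_mul_eq_one_left h.symm
  have h₆ : ∀ j, 1 - q ^ (-(8 * s : ℤ)) * (q ^ 4) ^ (j + 1) / f ≠ 0 := fun j => by
    rw [sub_ne_zero, ← pow_mul, ← zpow_natCast, ← zpow_add₀ hq, ne_comm, Ne, div_eq_one_iff_eq hf₀]
    exact (hf _).symm
  have h₇ : ∀ j, 1 - q ^ (-(8 * s : ℤ)) * (q ^ 4) ^ (2 * j + 3) ≠ 0 := fun j => by
    rw [sub_ne_zero, ← pow_mul, ← zpow_natCast, ← zpow_add₀ hq, ← zpow_zero q]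
    exact hne _ _ (by push_cast; omega)
  have h₈ : ∀ t, ∀ j < s, q ^ (-(8 * s : ℤ)) * (q ^ 4) ^ (2 * j) ≠ (q ^ 4) ^ (2 * t) :=
    fun t j hj => by
      rw [← pow_mul, ← pow_mul, ← zpow_natCast, ← zpow_natCast, ← zpow_add₀ hq]
      exact hne _ _ (by push_cast; omega)
  have h₃ : ∀ t, q ^ (-(8 * s : ℤ)) ≠ (q ^ 4) ^ (2 * t + 2) := fun t => by
    rw [← pow_mul, ← zpow_natCast]
    exact hne _ _ (by push_cast; omega)
  rw [← sum_subset (range_mono (by omega : s + 1 ≤ N + 1))]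
  · refine sum_quadTerm_eq_zero_of_forall_odd hp (fun t t' h => ?_) h₄ h₅ h₆ h₇ h₈
      (fun t => sum_quadTerm_odd hp (zpow_ne_zero _ hq) hf₀ hs h₄ h₅ h₆ h₇ h₈ h₃ t
        (Or.inr (hzero _ (by omega)))) (zpow_ne_zero _ hq) (fun j => ?_) (fun j => ?_)
    · have h' := inv_injective h
      rw [← pow_mul, ← pow_mul, ← zpow_natCast, ← zpow_natCast] at h'
      have := hinj h'
      omega
    · rw [sub_ne_zero, ← pow_mul, ← zpow_natCast, ← zpow_add₀ hq]
      exact hne _ _ (by push_cast; omega)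
    · rw [sub_ne_zero, ← pow_mul, ← zpow_natCast, ← zpow_add₀ hq, ← zpow_add₀ hq, ← zpow_zero q]
      exact hne _ _ (by push_cast; omega)
  · intro k _ hk
    have : s < k := by simpa using hk
    rw [quadTerm, hzero k this]
    simp only [zero_mul, mul_zero, zero_div]

open Polynomial in
theorem mul_sub_dvd_eval_of_three_roots {O : Type*} [CommRing O] [IsDomain O] {P : O[X]}
    {r₁ r₂ r₃ : O} (h₁ : P.IsRoot r₁) (h₂ : P.IsRoot r₂) (h₃ : P.IsRoot r₃) (h₁₂ : r₁ ≠ r₂)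
    (h₁₃ : r₁ ≠ r₃) (h₂₃ : r₂ ≠ r₃) (x : O) :
    (x - r₁) * (x - r₂) * (x - r₃) ∣ P.eval x := by
  obtain ⟨P₁, rfl⟩ := dvd_iff_isRoot.2 h₁
  have h₂' : P₁.IsRoot r₂ := by simpa [sub_eq_zero, h₁₂.symm] using h₂
  obtain ⟨P₂, rfl⟩ := dvd_iff_isRoot.2 h₂'
  have h₃' : P₂.IsRoot r₃ := by simpa [sub_eq_zero, h₁₃.symm, h₂₃.symm] using h₃
  obtain ⟨P₃, rfl⟩ := dvd_iff_isRoot.2 h₃'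
  exact ⟨P₃.eval x, by simp; ring⟩

section Cleared

open Polynomial

variable {O : Type*} [CommRing O] (q e : O)

/-- The linear factor of the summand along the curve `a = X`, `b = q ^ 2 / X`. -/
def curveCoeff (k : ℕ) : O[X] := 1 - C (q ^ (12 * k)) * X

/-- The numerator of the term ratio along the curve `a = X`, `b = q ^ 2 / X`. -/
def curveNum (j : ℕ) : O[X] :=
  (1 - C (q ^ (4 * j)) * X) * (X - C (q ^ (4 * j + 2))) * (1 - C (q ^ (4 * j + 2)) * X) *
    (1 - C (q ^ (8 * j)) * X) * C (1 - e * q ^ (8 * j)) * (C e - C (q ^ (8 * j + 4)) * X) *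
    C (q ^ 4)

/-- The denominator of the term ratio along the curve `a = X`, `b = q ^ 2 / X`. -/
def curveDen (j : ℕ) : O[X] :=
  X * (1 - C (q ^ (8 * j + 6)) * X ^ 2) * (C e - C (q ^ (4 * j + 4)) * X) *
    C ((1 - q ^ (8 * j + 8)) * (1 - q ^ (8 * j + 6)) * (1 - q ^ (4 * j + 4)) *
      (1 - e * q ^ (4 * j)))

variable {q e} {K : Type*} [Field K] [Algebra O K]

theorem aeval_curveDen (x : K) (j : ℕ) :
    aeval x (curveDen q e j) = x * (1 - algebraMap O K q ^ (8 * j + 6) * x ^ 2) *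
      (algebraMap O K e - algebraMap O K q ^ (4 * j + 4) * x) *
      ((1 - algebraMap O K q ^ (8 * j + 8)) * (1 - algebraMap O K q ^ (8 * j + 6)) *
        (1 - algebraMap O K q ^ (4 * j + 4)) *
        (1 - algebraMap O K e * algebraMap O K q ^ (4 * j))) := by
  simp [curveDen]

theorem aeval_curveNum_div {x : K} (hx : x ≠ 0) (he : algebraMap O K e ≠ 0) (j : ℕ) :
    aeval x (curveNum q e j) / aeval x (curveDen q e j) =
      quadRatio (algebraMap O K q ^ 4) x (algebraMap O K q ^ 2 / x) (algebraMap O K e) j := by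
  rw [aeval_curveDen]
  simp only [curveNum, map_mul, map_sub, map_one, map_pow, aeval_C, aeval_X]
  generalize algebraMap O K q = Q at *
  generalize algebraMap O K e = f at *
  have e₁ : x - Q ^ (4 * j + 2) = x * (1 - Q ^ 2 / x * (Q ^ 4) ^ j) := by field_simp; ring
  have e₂ : 1 - Q ^ 4 / (Q ^ 2 / x) * (Q ^ 4) ^ j = 1 - Q ^ (4 * j + 2) * x := by
    field_simp; ring
  have e₃ : 1 - x * (Q ^ 4) ^ 2 / (Q ^ 2 / x) * ((Q ^ 4) ^ 2) ^ j =
      1 - Q ^ (8 * j + 6) * x ^ 2 := by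
    field_simp; ring
  have e₄ : 1 - x * (Q ^ 2 / x) * Q ^ 4 * ((Q ^ 4) ^ 2) ^ j = 1 - Q ^ (8 * j + 6) := by
    field_simp; ring
  have e₅ : f - Q ^ (8 * j + 4) * x = f * (1 - x * Q ^ 4 / f * ((Q ^ 4) ^ 2) ^ j) := by
    field_simp; ring
  have e₆ : f - Q ^ (4 * j + 4) * x = f * (1 - x * Q ^ 4 / f * (Q ^ 4) ^ j) := by
    field_simp; ring
  have e₇ : 1 - (Q ^ 4) ^ 2 * ((Q ^ 4) ^ 2) ^ j = 1 - Q ^ (8 * j + 8) := by ring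
  have e₈ : 1 - Q ^ 4 * (Q ^ 4) ^ j = 1 - Q ^ (4 * j + 4) := by ring
  have e₉ : ((Q ^ 4) ^ 2) ^ j = Q ^ (8 * j) := by ring
  have e₁₀ : (Q ^ 4) ^ j = Q ^ (4 * j) := by ring
  rw [quadRatio, e₂, e₃, e₄, e₇, e₈, e₁, e₅, e₆, e₉, e₁₀]
  generalize 1 - Q ^ 2 / x * Q ^ (4 * j) = y₁
  generalize 1 - x * Q ^ 4 / f * Q ^ (8 * j) = y₂
  generalize 1 - x * Q ^ 4 / f * Q ^ (4 * j) = y₃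
  generalize 1 - Q ^ (8 * j + 6) * x ^ 2 = y₄
  generalize 1 - Q ^ (8 * j + 6) = y₅
  generalize 1 - Q ^ (8 * j + 8) = y₆
  generalize 1 - Q ^ (4 * j + 4) = y₇
  generalize Q ^ (4 * j + 2) = y₈
  generalize Q ^ (4 * j) = y₉
  generalize Q ^ (8 * j) = y₁₀
  calc _ = (x * f) * ((1 - y₉ * x) * y₁ * (1 - y₈ * x) * (1 - y₁₀ * x) * (1 - f * y₁₀) * y₂ *
        Q ^ 4) / ((x * f) * (y₄ * y₃ * (y₆ * y₅ * y₇ * (1 - f * y₉)))) := by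
        congr 1 <;> ring
    _ = _ := by
        rw [mul_div_mul_left _ _ (mul_ne_zero hx he)]
        simp only [div_eq_mul_inv, mul_inv]
        ring

theorem aeval_clearedSum_curve {x : K} (hx : x ≠ 0) (he : algebraMap O K e ≠ 0) {N : ℕ}
    (hv : ∀ j < N, aeval x (curveDen q e j) ≠ 0) :
    aeval x (clearedSum (curveCoeff q) (curveNum q e) (curveDen q e) N) =
      (∑ k ∈ range (N + 1), quadTerm (algebraMap O K q ^ 4) x (algebraMap O K q ^ 2 / x)
        (algebraMap O K e) k) * ∏ j ∈ range N, aeval x (curveDen q e j) := by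
  rw [aeval_clearedSum _ _ _ _ _ hv]
  congr 1
  refine sum_congr rfl fun k _ => ?_
  rw [quadTerm_eq_prod, prod_congr rfl fun j _ => aeval_curveNum_div hx he j]
  congr 1
  simp [curveCoeff]
  ring

end Cleared

theorem dvd_of_dvd_two_pow_mul {n i : ℕ} (hmod : n % 8 = 5) (m : ℕ) (h : n ∣ 2 ^ m * i) :
    n ∣ i :=
  (Nat.Coprime.pow_right m (Nat.coprime_two_right.2 (Nat.odd_iff.2 (by omega)))).dvd_of_dvd_mul_left
    h

section Divisibility

open Polynomial

variable {O K : Type*} [CommRing O] [Field K] [Algebra O K] {q e π : O} {n : ℕ}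

/-- The partial sum up to `N = 3 (n - 1) / 4` is divisible by `π ^ 3` in `O`. -/
theorem exists_sum_quadTerm_head [IsDomain O] [FaithfulSMul O K] (hmod : n % 8 = 5) (hq : IsUnit q)
    (hinj : Function.Injective fun i : ℤ => algebraMap O K q ^ i)
    (he : ∀ i : ℤ, algebraMap O K e ≠ algebraMap O K q ^ i) (he₀ : algebraMap O K e ≠ 0)
    (hπ : π ∣ 1 - q ^ n)
    (hunit : ∀ i, ¬ n ∣ i → IsUnit (1 - q ^ i)) (hunit₁ : ∀ i, IsUnit (e - q ^ i))
    (hunit₂ : ∀ i, IsUnit (1 - e * q ^ i)) {N : ℕ} (hN : 4 * N + 3 = 3 * n) :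
    ∃ w : O, ∑ k ∈ range (N + 1), quadTerm (algebraMap O K q ^ 4) (algebraMap O K q)
      (algebraMap O K q) (algebraMap O K e) k = algebraMap O K (π ^ 3 * w) := by
  obtain ⟨t, ht⟩ : ∃ t, n = 8 * t + 5 := ⟨n / 8, by omega⟩
  obtain ⟨qi, hqi⟩ := hq.exists_right_inv
  set Q := algebraMap O K q with hQ
  set f := algebraMap O K e with hf
  have hQ₀ : Q ≠ 0 := (hq.map (algebraMap O K)).ne_zero
  have hne : ∀ i j : ℤ, i ≠ j → Q ^ i ≠ Q ^ j := fun i j h h' => h (hinj h')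
  have hmapqi : ∀ m : ℕ, algebraMap O K (qi ^ m) = Q ^ (-(m : ℤ)) := by
    intro m
    have : Q * algebraMap O K qi = 1 := by rw [hQ, ← map_mul, hqi, map_one]
    rw [map_pow, eq_inv_of_mul_eq_one_right this, zpow_neg, zpow_natCast, inv_pow]
  set P := clearedSum (curveCoeff q) (curveNum q e) (curveDen q e) N with hP
  have hone : ∀ i : ℤ, i ≠ 0 → 1 - Q ^ i ≠ 0 := fun i hi => by
    rw [sub_ne_zero, ← zpow_zero Q]
    exact hne _ _ hi.symm
  have hden : ∀ r : ℤ, (∀ j : ℕ, 2 * r + (8 * j + 6) ≠ 0) →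
      ∀ j < N, aeval (Q ^ r) (curveDen q e j) ≠ 0 := by
    intro r hr j _
    rw [aeval_curveDen, ← hQ, ← hf]
    refine mul_ne_zero (mul_ne_zero (mul_ne_zero (zpow_ne_zero _ hQ₀) ?_) ?_)
      (mul_ne_zero (mul_ne_zero (mul_ne_zero ?_ ?_) ?_) ?_)
    · rw [← zpow_natCast, ← zpow_natCast (Q ^ r), ← zpow_mul, ← zpow_add₀ hQ₀]
      refine hone _ ?_
      have := hr j
      push_cast
      omega
    · rw [← zpow_natCast, ← zpow_add₀ hQ₀, sub_ne_zero]
      exact he _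
    · rw [← zpow_natCast]; exact hone _ (by push_cast; omega)
    · rw [← zpow_natCast]; exact hone _ (by push_cast; omega)
    · rw [← zpow_natCast]; exact hone _ (by push_cast; omega)
    · rw [hf, hQ, ← map_pow, ← map_mul, ← map_one (algebraMap O K), ← map_sub]
      exact ((hunit₂ _).map (algebraMap O K)).ne_zero
  have hroot : ∀ (r : ℤ) (x : O), algebraMap O K x = Q ^ r →
      (∀ j : ℕ, 2 * r + (8 * j + 6) ≠ 0) →
      ∑ k ∈ range (N + 1), quadTerm (Q ^ 4) (Q ^ r) (Q ^ (2 - r)) f k = 0 → P.IsRoot x := by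
    intro r x hx hr hsum
    have h := aeval_clearedSum_curve (zpow_ne_zero r hQ₀) he₀ (hden r hr)
    rw [← hQ, ← hf, ← hP, show Q ^ 2 / Q ^ r = Q ^ (2 - r) by
      rw [zpow_sub₀ hQ₀]; norm_cast, hsum, zero_mul, ← hx, aeval_algebraMap_apply] at h
    refine FaithfulSMul.algebraMap_injective O K ?_
    rw [map_zero, ← h]
    simp
  have hpow : ∀ m : ℕ, (Q ^ 4) ^ m = Q ^ (4 * m : ℤ) := fun m => by
    rw [← pow_mul]; norm_cast
  have root₁ : P.IsRoot (q ^ (n + 1)) := by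
    refine hroot (n + 1) _ (by rw [map_pow, ← hQ]; norm_cast) (fun j => by omega) ?_
    rw [show Q ^ (2 - ((n : ℤ) + 1)) = ((Q ^ 4) ^ (2 * t + 1))⁻¹ by
      rw [hpow, ← zpow_neg]; congr 1; push_cast; omega]
    exact sum_quadTerm_zpow_odd hQ₀ hinj he₀ he (by omega) (by omega)
  have root₂ : P.IsRoot (qi ^ (3 * n - 1)) := by
    refine hroot _ _ (hmapqi _) (fun j => by omega) ?_
    rw [show Q ^ (2 - -((3 * n - 1 : ℕ) : ℤ)) = Q ^ 4 / ((Q ^ 4) ^ (2 * (3 * t + 1) + 1))⁻¹ by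
      rw [div_inv_eq_mul, ← pow_succ', hpow]; congr 1; push_cast; omega]
    simp only [quadTerm_div (pow_ne_zero 4 hQ₀)]
    exact sum_quadTerm_zpow_odd hQ₀ hinj he₀ he (by omega) (by omega)
  have root₃ : P.IsRoot (qi ^ (5 * n - 1)) := by
    refine hroot _ _ (hmapqi _) (fun j => by omega) ?_
    rw [show -((5 * n - 1 : ℕ) : ℤ) = -(8 * (5 * t + 3 : ℕ) : ℤ) by push_cast; omega]
    exact sum_quadTerm_zpow_neg hQ₀ hinj he₀ he (by push_cast; omega) (by omega) (by omega)
  have hinjO : ∀ x y : O, algebraMap O K x ≠ algebraMap O K y → x ≠ y :=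
    fun x y h h' => h (congrArg _ h')
  have hdvd := mul_sub_dvd_eval_of_three_roots root₁ root₂ root₃
    (hinjO _ _ (by
      rw [map_pow, hmapqi, ← hQ, ← zpow_natCast]; exact hne _ _ (by push_cast; omega)))
    (hinjO _ _ (by
      rw [map_pow, hmapqi, ← hQ, ← zpow_natCast]; exact hne _ _ (by push_cast; omega)))
    (hinjO _ _ (by rw [hmapqi, hmapqi]; exact hne _ _ (by omega))) q
  have hπm : ∀ m, π ∣ 1 - q ^ (n * m) := fun m => hπ.trans (by
    rw [pow_mul]; exact one_sub_dvd_one_sub_pow _ m)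
  have hπi : ∀ m, 1 ≤ n * m → π ∣ q - qi ^ (n * m - 1) := by
    intro m hm
    have h : q - qi ^ (n * m - 1) = -(qi ^ (n * m - 1) * (1 - q ^ (n * m))) := by
      obtain ⟨s, hs⟩ : ∃ s, n * m = s + 1 := ⟨n * m - 1, by omega⟩
      have : qi ^ s * q ^ s = 1 := by rw [← mul_pow, mul_comm, hqi, one_pow]
      rw [hs, Nat.add_sub_cancel, pow_succ q s]
      linear_combination (-q) * this
    rw [h, dvd_neg]
    exact (hπm m).mul_left _
  have hdvd' : π ^ 3 ∣ P.eval q := by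
    refine dvd_trans ?_ hdvd
    rw [pow_succ, sq]
    refine mul_dvd_mul (mul_dvd_mul ?_ ?_) ?_
    · rw [show q - q ^ (n + 1) = q * (1 - q ^ n) by ring]
      exact hπ.mul_left _
    · rw [mul_comm 3 n]; exact hπi 3 (by omega)
    · rw [mul_comm 5 n]; exact hπi 5 (by omega)
  have hlt : ∀ i, 0 < i → i < 3 * n → n ∣ i → i = n ∨ i = 2 * n := by
    rintro i h0 h3 ⟨c, rfl⟩
    have h1 : c < 3 := by nlinarith
    interval_cases c <;> omega
  have hunitDen : ∀ j < N, IsUnit ((curveDen q e j).eval q) := by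
    intro j hj
    have hev : (curveDen q e j).eval q = q * (1 - q ^ (8 * j + 8)) * (e - q ^ (4 * j + 5)) *
        ((1 - q ^ (8 * j + 8)) * (1 - q ^ (8 * j + 6)) * (1 - q ^ (4 * j + 4)) *
          (1 - e * q ^ (4 * j))) := by
      simp only [curveDen, eval_mul, eval_sub, eval_one, eval_C, eval_X, eval_pow]
      ring
    have u₁ : ¬ n ∣ j + 1 := fun h => by
      have := Nat.le_of_dvd (by omega) h
      omega
    have u₂ : ¬ n ∣ 4 * j + 3 := fun h => by
      have := hlt _ (by omega) (by omega) h
      omega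
    rw [hev]
    refine ((hq.mul (hunit _ ?_)).mul (hunit₁ _)).mul
      ((((hunit _ ?_).mul (hunit _ ?_)).mul (hunit _ ?_)).mul (hunit₂ _))
    · exact fun h => u₁ (dvd_of_dvd_two_pow_mul hmod 3 (by convert h using 1; ring))
    · exact fun h => u₁ (dvd_of_dvd_two_pow_mul hmod 3 (by convert h using 1; ring))
    · exact fun h => u₂ (dvd_of_dvd_two_pow_mul hmod 1 (by convert h using 1; ring))
    · exact fun h => u₁ (dvd_of_dvd_two_pow_mul hmod 2 (by convert h using 1; ring))
  have hprod : IsUnit (∏ j ∈ range N, (curveDen q e j).eval q) :=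
    (IsUnit.prod_iff).2 fun j hj => hunitDen j (mem_range.1 hj)
  obtain ⟨y, hy⟩ := hprod.exists_right_inv
  obtain ⟨w, hw⟩ := hdvd'
  have haeval : ∀ p : O[X], aeval Q p = algebraMap O K (p.eval q) := fun p => by
    rw [hQ, aeval_algebraMap_apply, coe_aeval_eq_eval]
  have h := aeval_clearedSum_curve (N := N) (x := Q) hQ₀ he₀ fun j hj => by
    rw [haeval]
    exact ((hunitDen j hj).map (algebraMap O K)).ne_zero
  simp only [haeval] at h
  rw [← hP, hw, ← map_prod, ← hQ, ← hf, sq, mul_div_cancel_right₀ _ hQ₀] at h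
  refine ⟨w * y, ?_⟩
  rw [← mul_assoc, map_mul, h, mul_assoc, ← map_mul, hy, map_one, mul_one]

theorem exists_quadTerm_tail (hmod : n % 8 = 5) (hq : IsUnit q)
    (hinj : Function.Injective fun i : ℤ => algebraMap O K q ^ i)
    (he₀ : algebraMap O K e ≠ 0) (hπ : π ∣ 1 - q ^ n)
    (hunit : ∀ i, ¬ n ∣ i → IsUnit (1 - q ^ i)) (hunit₁ : ∀ i, IsUnit (e - q ^ i))
    (hunit₂ : ∀ i, IsUnit (1 - e * q ^ i)) (hunit₃ : ∀ i, Odd i → IsUnit (1 + q ^ i))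
    {N k : ℕ} (hN : 4 * N + 3 = 3 * n) (hk : N < k) (hkn : k < n) :
    ∃ w : O, quadTerm (algebraMap O K q ^ 4) (algebraMap O K q)
      (algebraMap O K q) (algebraMap O K e) k = algebraMap O K (π ^ 3 * w) := by
  obtain ⟨t, ht⟩ : ∃ t, n = 8 * t + 5 := ⟨n / 8, by omega⟩
  let u : ℕ → O := fun j => (1 - q ^ (4 * j + 1)) ^ 2 * (1 - q ^ (8 * j + 1)) *
    (1 - e * q ^ (8 * j)) * (e - q ^ (8 * j + 5)) * q ^ 4
  let v : ℕ → O := fun j => (1 - q ^ (8 * j + 8)) ^ 2 * (1 + q ^ (4 * j + 3)) *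
    (1 - q ^ (4 * j + 4)) * (e - q ^ (4 * j + 5)) * (1 - e * q ^ (4 * j))
  have hratio : ∀ j, quadRatio (algebraMap O K q ^ 4) (algebraMap O K q) (algebraMap O K q)
      (algebraMap O K e) j = algebraMap O K (u j) / algebraMap O K (v j) := by
    intro j
    have hQ₀ : algebraMap O K q ≠ 0 := (hq.map (algebraMap O K)).ne_zero
    simp only [u, v, map_mul, map_sub, map_add, map_one, map_pow]
    generalize algebraMap O K q = Q at *
    generalize algebraMap O K e = f at *
    have h₃ : 1 - Q ^ (4 * j + 3) ≠ 0 := by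
      intro h
      have := @hinj 0 (4 * j + 3 : ℕ) (by
        simp only [zpow_zero, zpow_natCast]; linear_combination h)
      omega
    have e₁ : 1 - Q ^ 4 / Q * (Q ^ 4) ^ j = 1 - Q ^ (4 * j + 3) := by field_simp; ring
    have e₂ : 1 - Q * Q * Q ^ 4 * ((Q ^ 4) ^ 2) ^ j =
        (1 - Q ^ (4 * j + 3)) * (1 + Q ^ (4 * j + 3)) := by ring
    have e₃ : f - Q ^ (8 * j + 5) = f * (1 - Q * Q ^ 4 / f * ((Q ^ 4) ^ 2) ^ j) := by
      field_simp; ring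
    have e₄ : f - Q ^ (4 * j + 5) = f * (1 - Q * Q ^ 4 / f * (Q ^ 4) ^ j) := by
      field_simp; ring
    have e₅ : Q * (Q ^ 4) ^ 2 / Q = Q ^ 8 := by field_simp
    rw [quadRatio, e₁, e₂, e₃, e₄, e₅]
    generalize 1 - Q * Q ^ 4 / f * ((Q ^ 4) ^ 2) ^ j = y₁
    generalize 1 - Q * Q ^ 4 / f * (Q ^ 4) ^ j = y₂
    generalize 1 - Q ^ (4 * j + 3) = y₃ at *
    generalize 1 + Q ^ (4 * j + 3) = y₄
    rw [show 1 - Q ^ 8 * ((Q ^ 4) ^ 2) ^ j = 1 - Q ^ (8 * j + 8) by ring,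
      show 1 - (Q ^ 4) ^ 2 * ((Q ^ 4) ^ 2) ^ j = 1 - Q ^ (8 * j + 8) by ring,
      show 1 - Q ^ 4 * (Q ^ 4) ^ j = 1 - Q ^ (4 * j + 4) by ring,
      show 1 - Q * (Q ^ 4) ^ j = 1 - Q ^ (4 * j + 1) by ring,
      show 1 - Q * ((Q ^ 4) ^ 2) ^ j = 1 - Q ^ (8 * j + 1) by ring,
      show 1 - f * ((Q ^ 4) ^ 2) ^ j = 1 - f * Q ^ (8 * j) by ring,
      show 1 - f * (Q ^ 4) ^ j = 1 - f * Q ^ (4 * j) by ring]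
    generalize 1 - Q ^ (8 * j + 8) = y₅
    generalize 1 - Q ^ (4 * j + 4) = y₆
    generalize 1 - Q ^ (4 * j + 1) = y₇
    generalize 1 - Q ^ (8 * j + 1) = y₈
    generalize 1 - f * Q ^ (8 * j) = y₉
    generalize 1 - f * Q ^ (4 * j) = y₁₀
    calc _ = y₃ * (y₇ ^ 2 * y₈ * y₉ * y₁ * Q ^ 4) / (y₃ * (y₅ ^ 2 * y₄ * y₆ * y₂ * y₁₀)) := by
          rw [div_mul_eq_mul_div]; congr 1 <;> ring
      _ = f * (y₇ ^ 2 * y₈ * y₉ * y₁ * Q ^ 4) / (f * (y₅ ^ 2 * y₄ * y₆ * y₂ * y₁₀)) := by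
          rw [mul_div_mul_left _ _ h₃, mul_div_mul_left _ _ he₀]
      _ = _ := by congr 1 <;> ring
  have hv : ∀ j < k, IsUnit (v j) := by
    intro j hj
    have u₁ : ¬ n ∣ j + 1 := fun h => by
      have := Nat.le_of_dvd (by omega) h
      omega
    refine ((((IsUnit.pow 2 (hunit _ ?_)).mul (hunit₃ _ ?_)).mul (hunit _ ?_)).mul
      (hunit₁ _)).mul (hunit₂ _)
    · exact fun h => u₁ (dvd_of_dvd_two_pow_mul hmod 3 (by convert h using 1; ring))
    · exact ⟨2 * j + 1, by ring⟩
    · exact fun h => u₁ (dvd_of_dvd_two_pow_mul hmod 2 (by convert h using 1; ring))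
  obtain ⟨y, hy⟩ := ((IsUnit.prod_iff).2 fun j hj =>
    hv j (mem_range.1 hj) : IsUnit (∏ j ∈ range k, v j)).exists_right_inv
  have hu : π ^ 3 ∣ ∏ j ∈ range k, u j := by
    have hsub : ({2 * t + 1, 5 * t + 3} : Finset ℕ) ⊆ range k := by
      intro j hj
      simp only [mem_insert, mem_singleton] at hj
      simp only [mem_range]
      omega
    refine dvd_trans ?_ (prod_dvd_prod_of_subset _ _ u hsub)
    rw [prod_pair (by omega), pow_succ]
    refine mul_dvd_mul ?_ ?_
    · simp only [u, mul_assoc]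
      rw [show 4 * (2 * t + 1) + 1 = n by omega]
      exact (pow_dvd_pow_of_dvd hπ 2).mul_right _
    · have : π ∣ 1 - q ^ (8 * (5 * t + 3) + 1) := by
        rw [show 8 * (5 * t + 3) + 1 = n * 5 by omega, pow_mul]
        exact hπ.trans (one_sub_dvd_one_sub_pow _ 5)
      simp only [u, mul_assoc]
      exact (this.mul_right _).mul_left _
  obtain ⟨w, hw⟩ := hu
  refine ⟨w * y * (1 - q * q ^ (12 * k)), ?_⟩
  have hy' := congrArg (algebraMap O K) hy
  rw [map_mul, map_one] at hy'
  rw [quadTerm_eq_prod, prod_congr rfl fun j _ => hratio j, prod_div_distrib, ← map_prod,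
    ← map_prod, hw, div_eq_mul_inv, inv_eq_of_mul_eq_one_right hy']
  simp only [map_mul, map_sub, map_one, map_pow]
  ring

/-- The sum is divisible by `π ^ 3` in `O`. -/
theorem exists_sum_quadTerm [IsDomain O] [FaithfulSMul O K] (hmod : n % 8 = 5) (hq : IsUnit q)
    (hinj : Function.Injective fun i : ℤ => algebraMap O K q ^ i)
    (he : ∀ i : ℤ, algebraMap O K e ≠ algebraMap O K q ^ i) (he₀ : algebraMap O K e ≠ 0)
    (hπ : π ∣ 1 - q ^ n)
    (hunit : ∀ i, ¬ n ∣ i → IsUnit (1 - q ^ i)) (hunit₁ : ∀ i, IsUnit (e - q ^ i))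
    (hunit₂ : ∀ i, IsUnit (1 - e * q ^ i)) (hunit₃ : ∀ i, Odd i → IsUnit (1 + q ^ i)) :
    ∃ w : O, ∑ k ∈ range n, quadTerm (algebraMap O K q ^ 4) (algebraMap O K q)
      (algebraMap O K q) (algebraMap O K e) k = algebraMap O K (π ^ 3 * w) := by
  obtain ⟨N, hN⟩ : ∃ N, 4 * N + 3 = 3 * n := ⟨(3 * n - 3) / 4, by omega⟩
  obtain ⟨w, hw⟩ := exists_sum_quadTerm_head hmod hq hinj he he₀ hπ hunit hunit₁ hunit₂ hN
  have htail : ∀ k, ∃ w : O, k ∈ Ico (N + 1) n → quadTerm (algebraMap O K q ^ 4)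
      (algebraMap O K q) (algebraMap O K q) (algebraMap O K e) k =
        algebraMap O K (π ^ 3 * w) := by
    intro k
    by_cases hk : k ∈ Ico (N + 1) n
    · have hk' := mem_Ico.1 hk
      obtain ⟨w, hw⟩ := exists_quadTerm_tail hmod hq hinj he₀ hπ hunit hunit₁ hunit₂ hunit₃ hN
        (by omega : N < k) hk'.2
      exact ⟨w, fun _ => hw⟩
    · exact ⟨0, fun h => absurd h hk⟩
  choose w' hw' using htail
  refine ⟨w + ∑ k ∈ Ico (N + 1) n, w' k, ?_⟩
  rw [← sum_range_add_sum_Ico _ (by omega : N + 1 ≤ n), hw, sum_congr rfl hw', ← map_sum,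
    ← map_add, mul_add, mul_sum]

end Divisibility

section Specialization

open MvPolynomial

theorem prime_Phi2 {n : ℕ} (hn : 0 < n) : Prime (Phi2 n) := by
  have h₁ : Prime (Polynomial.cyclotomic n ℚ) := (Polynomial.cyclotomic.irreducible_rat hn).prime
  have h₂ := (MulEquiv.prime_iff
    (uniqueAlgEquiv ℚ ({0} : Set (Fin 2))).symm.toMulEquiv).2 h₁
  have h₃ := (prime_rename_iff ({0} : Set (Fin 2))).2 h₂
  convert h₃ using 1
  change Phi2 n = ((rename _).comp (uniqueAlgEquiv ℚ ({0} : Set (Fin 2))).symm.toAlgHom)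
    (Polynomial.cyclotomic n ℚ)
  rw [Phi2]
  congr 1
  ext
  simp [uniqueAlgEquiv]

theorem Phi2_dvd (n : ℕ) : Phi2 n ∣ 1 - X 0 ^ n := by
  have h := map_dvd (Polynomial.aeval (X 0 : R2)) (Polynomial.cyclotomic.dvd_X_pow_sub_one n ℚ)
  rw [← neg_sub, dvd_neg]
  simpa [Phi2] using h

theorem aeval_Phi2 {n : ℕ} {ζ : ℂ} (hζ : IsPrimitiveRoot ζ n) (hn : 0 < n) :
    aeval ![ζ, 0] (Phi2 n) = 0 := by
  rw [Phi2, ← Polynomial.aeval_algHom_apply, aeval_X, Matrix.cons_val_zero,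
    Polynomial.aeval_def, ← Polynomial.eval_map, Polynomial.map_cyclotomic]
  exact hζ.isRoot_cyclotomic hn

theorem qv_ne_zero : qv ≠ 0 := by
  simp [qv]

theorem ev_ne_zero : ev ≠ 0 := by
  simp [ev]

theorem qv_pow_ne_one {m : ℕ} (hm : m ≠ 0) : qv ^ m ≠ 1 := by
  intro h
  rw [qv, ← map_pow, ← map_one (algebraMap R2 K2)] at h
  have h' := congrArg (eval ![0, 0]) (IsFractionRing.injective R2 K2 h)
  simp [hm] at h'

theorem qv_zpow_injective : Function.Injective fun i : ℤ => qv ^ i := by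
  have key : ∀ i j : ℤ, i < j → qv ^ i ≠ qv ^ j := by
    intro i j hij h
    obtain ⟨m, hm⟩ := Int.eq_ofNat_of_zero_le (sub_nonneg.2 hij.le)
    refine qv_pow_ne_one (m := m) (by omega) ?_
    rw [← zpow_natCast, ← hm, zpow_sub₀ qv_ne_zero, h, div_self (zpow_ne_zero _ qv_ne_zero)]
  intro i j h
  rcases lt_trichotomy i j with hij | hij | hij
  · exact absurd h (key i j hij)
  · exact hij
  · exact absurd h.symm (key j i hij)

theorem ev_ne_qv_zpow (i : ℤ) : ev ≠ qv ^ i := by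
  intro h
  obtain ⟨m, rfl | rfl⟩ := i.eq_nat_or_neg
  · rw [zpow_natCast, qv, ev, ← map_pow] at h
    have h' := congrArg (eval ![1, 0]) (IsFractionRing.injective R2 K2 h)
    simp at h'
  · rw [zpow_neg, zpow_natCast, ← one_div, eq_div_iff (pow_ne_zero _ qv_ne_zero), qv, ev,
      ← map_pow, ← map_mul, ← map_one (algebraMap R2 K2)] at h
    have h' := congrArg (eval ![1, 0]) (IsFractionRing.injective R2 K2 h)
    simp at h'

/-- The sum is `Φ_n(q)^3` times a rational function whose denominator does not vanish at
`(q, e) = (ζ, 0)`, where `ζ` is a primitive `n`-th root of unity. -/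
theorem exists_sum_quadTerm_mul_eq {n : ℕ} (hmod : n % 8 = 5) {ζ : ℂ}
    (hζ : IsPrimitiveRoot ζ n) :
    ∃ f g : R2, aeval ![ζ, 0] g ≠ 0 ∧
      (∑ k ∈ range n, quadTerm (qv ^ 4) qv qv ev k) * algebraMap R2 K2 g =
        algebraMap R2 K2 (Phi2 n ^ 3) * algebraMap R2 K2 f := by
  let ψ : R2 →ₐ[ℚ] ℂ := aeval ![ζ, 0]
  let S : Submonoid R2 := (nonZeroDivisors ℂ).comap ψ
  have hmem : ∀ g, g ∈ S ↔ ψ g ≠ 0 := fun g => mem_nonZeroDivisors_iff_ne_zero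
  have hS : S ≤ nonZeroDivisors R2 := fun g hg =>
    mem_nonZeroDivisors_of_ne_zero fun h => (hmem g).1 hg (by rw [h, map_zero])
  let O := Localization.subalgebra.ofField K2 S hS
  have unit_of : ∀ g, ψ g ≠ 0 → IsUnit (algebraMap R2 O g) := fun g hg =>
    IsLocalization.map_units O (⟨g, (hmem g).2 hg⟩ : S)
  have hζ₀ : ζ ≠ 0 := hζ.ne_zero (by omega)
  have h₀ : ψ (X 0) = ζ := by simp [ψ]
  have h₁ : ψ (X 1) = 0 := by simp [ψ]
  obtain ⟨w, hw⟩ := exists_sum_quadTerm (O := O) (K := K2) (q := algebraMap R2 O (X 0))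
    (e := algebraMap R2 O (X 1)) (π := algebraMap R2 O (Phi2 n)) hmod
    (unit_of _ (by rwa [h₀])) qv_zpow_injective ev_ne_qv_zpow ev_ne_zero
    (by simpa using map_dvd (algebraMap R2 O) (Phi2_dvd n))
    (fun i hi => by
      have := unit_of (1 - X 0 ^ i) (by
        rw [map_sub, map_pow, map_one, h₀, sub_ne_zero]
        exact fun h => hi ((hζ.pow_eq_one_iff_dvd i).1 h.symm))
      simpa using this)
    (fun i => by
      have := unit_of (X 1 - X 0 ^ i) (by simp [h₀, h₁, hζ₀])
      simpa using this)
    (fun i => by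
      have := unit_of (1 - X 1 * X 0 ^ i) (by simp [h₁])
      simpa using this)
    (fun i _ => by
      have := unit_of (1 + X 0 ^ i) (by
        rw [map_add, map_pow, map_one, h₀]
        intro h
        have h' : ζ ^ i = -1 := by linear_combination h
        have h2 : ζ ^ (2 ^ 1 * i) = 1 := by rw [mul_comm, pow_mul, h']; norm_num
        have := (hζ.pow_eq_one_iff_dvd i).2
          (dvd_of_dvd_two_pow_mul hmod 1 ((hζ.pow_eq_one_iff_dvd _).1 h2))
        rw [this] at h'
        norm_num at h')
      simpa using this)
  obtain ⟨⟨f, g⟩, hfg⟩ := IsLocalization.surj S w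
  refine ⟨f, g, (hmem g).1 g.2, ?_⟩
  have hfg' := congrArg (algebraMap O K2) hfg
  rw [map_mul, ← IsScalarTower.algebraMap_apply, ← IsScalarTower.algebraMap_apply] at hfg'
  change (∑ k ∈ range n, quadTerm (qv ^ 4) qv qv ev k) = _ at hw
  rw [hw, map_mul, map_pow, ← IsScalarTower.algebraMap_apply, map_pow, mul_assoc, hfg']

theorem qInt_mul_eq_quadTerm_div (k : ℕ) :
    qInt qv (12 * (k : ℤ) + 1) *
      (qPoch qv (qv ^ 8) k * qPoch ev (qv ^ 8) k * qPoch (qv ^ 5 / ev) (qv ^ 8) k) *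
      (qPoch qv (qv ^ 4) k * qPoch qv (qv ^ 4) k * qPoch (qv ^ 3) (qv ^ 4) k) /
      (qPoch (qv ^ 4) (qv ^ 4) k * qPoch ev (qv ^ 4) k * qPoch (qv ^ 5 / ev) (qv ^ 4) k *
        (qPoch (qv ^ 8) (qv ^ 8) k * qPoch (qv ^ 8) (qv ^ 8) k * qPoch (qv ^ 6) (qv ^ 8) k)) *
      qv ^ (4 * k) = quadTerm (qv ^ 4) qv qv ev k / (1 - qv) := by
  have hq := qv_ne_zero
  rw [quadTerm, qInt, show qv ^ (12 * (k : ℤ) + 1) = qv * (qv ^ 4) ^ (3 * k) by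
      rw [← pow_mul, ← pow_succ']; norm_cast; congr 1; ring,
    show qv ^ 4 / qv = qv ^ 3 by field_simp, show qv * qv ^ 4 / ev = qv ^ 5 / ev by ring,
    show qv * qv * qv ^ 4 = qv ^ 6 by ring,
    show qv * (qv ^ 4) ^ 2 / qv = qv ^ 8 by field_simp,
    show (qv ^ 4) ^ 2 = qv ^ 8 by ring, pow_mul qv 4 k]
  ring

end Specialization

/-- Conjecture 5.2 for `d = 4`: for `n ≡ 5 (mod 8)`,
`Σ_{k=0}^{n-1} [12k+1] (q,e,q^5/e;q^8)_k (q,q,q^3;q^4)_k /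
((q^4,e,q^5/e;q^4)_k (q^8,q^8,q^6;q^8)_k) q^{4k} ≡ 0 (mod Φ_n(q)^3)`. -/
theorem stmt19 (n : ℕ) (hn : 0 < n) (hmod : n % 8 = 5) :
    CongrMod2
      (∑ k ∈ Finset.range n,
        qInt qv (12 * (k : ℤ) + 1) *
          (qPoch qv (qv ^ 8) k * qPoch ev (qv ^ 8) k * qPoch (qv ^ 5 / ev) (qv ^ 8) k) *
          (qPoch qv (qv ^ 4) k * qPoch qv (qv ^ 4) k * qPoch (qv ^ 3) (qv ^ 4) k) /
          (qPoch (qv ^ 4) (qv ^ 4) k * qPoch ev (qv ^ 4) k * qPoch (qv ^ 5 / ev) (qv ^ 4) k *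
            (qPoch (qv ^ 8) (qv ^ 8) k * qPoch (qv ^ 8) (qv ^ 8) k *
              qPoch (qv ^ 6) (qv ^ 8) k)) *
          qv ^ (4 * k))
      0 (Phi2 n ^ 3) := by
  set ζ := Complex.exp (2 * Real.pi * Complex.I / n)
  have hζ : IsPrimitiveRoot ζ n := Complex.isPrimitiveRoot_exp n hn.ne'
  obtain ⟨f, g, hg, hfg⟩ := exists_sum_quadTerm_mul_eq hmod hζ
  have hq : 1 - qv ≠ 0 := sub_ne_zero.2 fun h => qv_pow_ne_one one_ne_zero (by rw [pow_one, ← h])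
  have hg' : MvPolynomial.aeval ![ζ, 0] (g * (1 - MvPolynomial.X 0)) ≠ 0 := by
    rw [map_mul]
    refine mul_ne_zero hg ?_
    simpa [sub_eq_zero] using (hζ.ne_one (by omega)).symm
  refine ⟨f, g * (1 - MvPolynomial.X 0), fun h => hg' (by rw [h, map_zero]), ?_, ?_⟩
  · intro p hp hpg hpM
    have hassoc := hp.associated_of_dvd (prime_Phi2 hn) (hp.dvd_of_dvd_pow hpM)
    obtain ⟨r, hr⟩ := hassoc.symm.dvd.trans hpg
    exact hg' (by rw [hr, map_mul, aeval_Phi2 hζ hn, zero_mul])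
  · rw [sub_zero, sum_congr rfl fun k _ => qInt_mul_eq_quadTerm_div k, ← sum_div, ← hfg, map_mul,
      map_sub, map_one, ← qv]
    field_simp

end
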